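/- arXiv:2503.23399 — 6 statements merged into one kernel-verified Lean document; each statement's English description precedes it below -/
import Mathlib

section
/- Let p be an odd prime and let θ : MvPolynomial (Fin p) ℤ → Polynomial (ZMod p) be the ring homomorphism determined by X i ↦ (((i : ℕ) + 1 : ZMod p)) • Polynomial.X. Then θ sends δ = ∏_{(i,j) : Fin p × Fin p, i ≠ j} (X i − X j) to −Polynomial.X ^ (p² − p). -/
open MvPolynomial

lemma prod_nonzero_zmod (p : ℕ) [Fact p.Prime] :
    ∏ c : ZMod p, (if c ≠ 0 then c else 1) = -1 := by
  rw [← Finset.prod_filter]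
  have h := FiniteField.prod_univ_units_id_eq_neg_one (K := ZMod p)
  have h2 := congrArg (Units.coeHom (ZMod p)) h
  rw [map_prod] at h2
  simp only [Units.coeHom_apply, Units.val_neg, Units.val_one] at h2
  rw [← h2]
  symm
  refine Finset.prod_bij (fun u _ => (u : ZMod p)) ?_ ?_ ?_ ?_
  · intro u _
    simp
  · intro u _ v _ h
    exact Units.ext h
  · intro b hb
    simp only [Finset.mem_filter, Finset.mem_univ, true_and] at hb
    exact ⟨Units.mk0 b hb, Finset.mem_univ _, rfl⟩
  · intro u _
    rfl

lemma cast_fin_bijective (p : ℕ) [Fact p.Prime] :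
    Function.Bijective (fun i : Fin p => ((i : ℕ) : ZMod p)) := by
  rw [Fintype.bijective_iff_injective_and_card]
  refine ⟨?_, by simp [ZMod.card]⟩
  intro i j h
  have h' := (ZMod.natCast_eq_natCast_iff' _ _ _).1 h
  rw [Nat.mod_eq_of_lt i.2, Nat.mod_eq_of_lt j.2] at h'
  exact Fin.ext h'

lemma prod_diff_fin (p : ℕ) [Fact p.Prime] (hodd : Odd p) :
    ∏ ij ∈ Finset.univ.filter (fun ij : Fin p × Fin p => ij.1 ≠ ij.2),
      (((ij.1 : ℕ) : ZMod p) - ((ij.2 : ℕ) : ZMod p)) = -1 := by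
  rw [Finset.prod_filter, Fintype.prod_prod_type]
  have key : ∀ i : Fin p, ∏ j : Fin p, (if i ≠ j then
      (((i : ℕ) : ZMod p) - ((j : ℕ) : ZMod p)) else 1) = -1 := by
    intro i
    rw [← prod_nonzero_zmod p]
    refine Fintype.prod_bijective (fun j : Fin p => ((i : ℕ) : ZMod p) - ((j : ℕ) : ZMod p))
      ((Equiv.subLeft ((i : ℕ) : ZMod p)).bijective.comp (cast_fin_bijective p)) _ _ ?_
    intro j
    have : i ≠ j ↔ ((i : ℕ) : ZMod p) - ((j : ℕ) : ZMod p) ≠ 0 := by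
      rw [sub_ne_zero]
      exact (cast_fin_bijective p).1.ne_iff.symm
    simp only [this]
  simp only [key]
  simp [hodd.neg_one_pow]

/-- Equation (2): Θ_p(δ) = −η^{p²−p} mod p. -/
theorem theta_delta (p : ℕ) (hp : p.Prime) (hodd : Odd p) :
    MvPolynomial.aeval (fun i : Fin p => (((i : ℕ) + 1 : ZMod p)) • Polynomial.X)
      (∏ ij ∈ Finset.univ.filter (fun ij : Fin p × Fin p => ij.1 ≠ ij.2),
        (MvPolynomial.X ij.1 - MvPolynomial.X ij.2 : MvPolynomial (Fin p) ℤ)) =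
    -(Polynomial.X ^ (p ^ 2 - p) : Polynomial (ZMod p)) := by
  haveI : Fact p.Prime := ⟨hp⟩
  have hcard : (Finset.univ.filter (fun ij : Fin p × Fin p => ij.1 ≠ ij.2)).card = p ^ 2 - p := by
    have : Finset.univ.filter (fun ij : Fin p × Fin p => ij.1 ≠ ij.2)
        = (Finset.univ : Finset (Fin p)).offDiag := by
      ext x; simp
    rw [this, Finset.offDiag_card]
    simp [sq]
  rw [map_prod]
  have h : ∀ ij : Fin p × Fin p,
      MvPolynomial.aeval (fun i : Fin p => (((i : ℕ) + 1 : ZMod p)) • Polynomial.X)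
        (MvPolynomial.X ij.1 - MvPolynomial.X ij.2 : MvPolynomial (Fin p) ℤ) =
      Polynomial.C (((ij.1 : ℕ) : ZMod p) - ((ij.2 : ℕ) : ZMod p)) * Polynomial.X := by
    intro ij
    rw [map_sub, MvPolynomial.aeval_X, MvPolynomial.aeval_X, ← sub_smul,
      Polynomial.smul_eq_C_mul, add_sub_add_right_eq_sub]
  simp only [h]
  rw [Finset.prod_mul_distrib, ← map_prod, prod_diff_fin p hodd, Finset.prod_const, hcard]
  simp
end

section
/- Let p be an odd prime and let θ : MvPolynomial (Fin p) ℤ → Polynomial (ZMod p) be the ring homomorphism determined by X i ↦ (((i : ℕ) + 1 : ZMod p)) • Polynomial.X. Then the image under θ of the set K_p = {f ∈ MvPolynomial (Fin p) ℤ | f is symmetric and ∇ₚ f = 0} equals the subring of Polynomial (ZMod p) generated by the single element Polynomial.X ^ (p² − p), i.e. θ '' K_p = ↑(Subring.closure {Polynomial.X ^ (p² − p)}). -/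
open MvPolynomial

namespace ThetaAux

lemma chain {σ S : Type*} [Fintype σ] [CommRing S] [Algebra ℤ (Polynomial S)]
    (g : σ → Polynomial S) (f : MvPolynomial σ ℤ) :
    Polynomial.derivative (aeval g f) =
      ∑ i, aeval g (pderiv i f) * Polynomial.derivative (g i) := by
  classical
  induction f using MvPolynomial.induction_on with
  | C a => simp
  | add a b ha hb => simp [ha, hb, add_mul, Finset.sum_add_distrib]
  | mul_X q j hq =>
    have h1 : ∀ i, aeval g (pderiv i (q * X j)) * Polynomial.derivative (g i) =
        (if i = j then aeval g q * Polynomial.derivative (g j) else 0) +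
          (aeval g (pderiv i q) * Polynomial.derivative (g i)) * g j := by
      intro i
      rw [Derivation.leibniz, pderiv_X, smul_eq_mul, smul_eq_mul, map_add, map_mul, map_mul,
        aeval_X]
      by_cases h : i = j
      · subst h
        rw [Pi.single_eq_same, map_one, if_pos rfl]
        ring
      · rw [Pi.single_eq_of_ne (Ne.symm h), map_zero, if_neg h]
        ring
    rw [Finset.sum_congr rfl fun i _ => h1 i, Finset.sum_add_distrib, ← Finset.sum_mul, ← hq,
      Finset.sum_ite_eq' Finset.univ j, if_pos (Finset.mem_univ j), map_mul, aeval_X,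
      Polynomial.derivative_mul]
    ring

lemma transl {σ A : Type*} [Fintype σ] [CommRing A] [inst : Algebra ℤ A]
    (f : MvPolynomial σ ℤ) (hf : (∑ i, pderiv i f) = 0) (g : σ → A) (w : A) :
    aeval (fun i => g i + w) f = aeval g f := by
  obtain rfl : inst = Ring.toIntAlgebra A := Subsingleton.elim _ _
  set G : σ → Polynomial (MvPolynomial σ ℤ) := fun i => Polynomial.C (X i) + Polynomial.X with hG
  have h0 : Polynomial.derivative (aeval G f) = 0 := by
    rw [chain]
    have : ∀ i, Polynomial.derivative (G i) = 1 := by intro i; simp [hG]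
    simp only [this, mul_one, ← map_sum, hf, map_zero]
  have h1 := Polynomial.eq_C_of_natDegree_eq_zero
    (Polynomial.derivative_eq_zero.mp h0)
  have key : ∀ w : A, Polynomial.eval₂ (aeval g : MvPolynomial σ ℤ →ₐ[ℤ] A).toRingHom w
      (aeval G f) = aeval (fun i => g i + w) f := by
    intro w
    have : ((Polynomial.eval₂RingHom (aeval g : MvPolynomial σ ℤ →ₐ[ℤ] A).toRingHom w).toIntAlgHom.comp
      (aeval G)) = aeval (fun i => g i + w) := by
      apply MvPolynomial.algHom_ext
      intro i
      simp [hG]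
    exact DFunLike.congr_fun this f
  have k0 := key 0
  rw [← key w, h1, Polynomial.eval₂_C]
  rw [h1, Polynomial.eval₂_C] at k0
  simpa using k0

lemma pderiv_comm' {σ : Type*} (i j : σ) (f : MvPolynomial σ ℤ) :
    pderiv i (pderiv j f) = pderiv j (pderiv i f) := by
  classical
  have : ⁅(pderiv i : Derivation ℤ (MvPolynomial σ ℤ) (MvPolynomial σ ℤ)),
      (pderiv j : Derivation ℤ (MvPolynomial σ ℤ) (MvPolynomial σ ℤ))⁆ = 0 := by
    apply MvPolynomial.derivation_ext
    intro k
    rw [Derivation.commutator_apply]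
    simp [pderiv_X, Pi.single_apply, apply_ite]
  have h := DFunLike.congr_fun this f
  rw [Derivation.commutator_apply] at h
  exact sub_eq_zero.mp h

lemma sum_app {p : ℕ} (f : MvPolynomial (Fin p) ℤ) :
    (∑ i : Fin p, MvPolynomial.pderiv i) f = ∑ i : Fin p, MvPolynomial.pderiv i f := by
  rw [← Derivation.coeFnAddMonoidHom_apply, map_sum, Finset.sum_apply]
  rfl

lemma exists_c (p : ℕ) [Fact p.Prime] :
    ∃ c : Fin p ≃ ZMod p, ∀ i, c i = ((i : ℕ) + 1 : ZMod p) := by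
  refine ⟨Equiv.ofBijective (fun i => ((i : ℕ) + 1 : ZMod p)) ?_, fun i => rfl⟩
  rw [Fintype.bijective_iff_injective_and_card]
  refine ⟨fun i j h => ?_, by simp [ZMod.card]⟩
  have h' := add_right_cancel h
  rw [ZMod.natCast_eq_natCast_iff'] at h'
  rw [Nat.mod_eq_of_lt i.2, Nat.mod_eq_of_lt j.2] at h'
  exact Fin.ext h'

section
variable {p : ℕ} [Fact p.Prime] (c : Fin p ≃ ZMod p)

noncomputable abbrev th : MvPolynomial (Fin p) ℤ →ₐ[ℤ] Polynomial (ZMod p) :=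
  aeval (fun i => c i • Polynomial.X)

lemma deriv_zero (hodd : Odd p) (f : MvPolynomial (Fin p) ℤ) (hs : f.IsSymmetric)
    (hf : ∑ i, pderiv i f = 0) : Polynomial.derivative (th c f) = 0 := by
  have hp : p.Prime := Fact.out
  have hconst : ∀ i j, th c (pderiv j f) = th c (pderiv i f) := by
    intro i j
    set s := c j - c i with hsdef
    let e : Equiv.Perm (Fin p) := (c.trans (Equiv.addRight s)).trans c.symm
    have he : ∀ k, c (e k) = c k + s := by intro k; simp [e]
    have hej : e i = j := by apply c.injective; rw [he]; simp [hsdef]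
    have h1 : pderiv j f = rename e (pderiv i f) := by
      rw [← hej, ← pderiv_rename e.injective, hs e]
    rw [h1, aeval_rename]
    have h2 : ((fun i => c i • Polynomial.X) ∘ e : Fin p → Polynomial (ZMod p)) =
        fun k => c k • Polynomial.X + s • Polynomial.X := by
      funext k; simp [he, add_smul]
    rw [h2]
    apply transl
    have : ∀ k, pderiv k (pderiv i f) = pderiv i (pderiv k f) := fun k => pderiv_comm' _ _ _
    simp only [this, ← map_sum, hf, map_zero]
  rw [chain]
  have i0 : Fin p := ⟨0, hp.pos⟩
  have h3 : ∀ i, aeval (fun i => c i • Polynomial.X) (pderiv i f) *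
      Polynomial.derivative (c i • Polynomial.X) =
      th c (pderiv i0 f) * Polynomial.C (c i) := by
    intro i
    have := hconst i0 i
    have h8 : Polynomial.derivative (c i • (Polynomial.X : Polynomial (ZMod p))) =
        Polynomial.C (c i) := by simp [Polynomial.smul_eq_C_mul]
    rw [h8, ← this]
  simp only [h3]
  rw [← Finset.mul_sum, ← map_sum, Equiv.sum_comp c (fun x => x)]
  have h4 : ∑ x : ZMod p, x = 0 := by
    have h5 : ∑ x : ZMod p, x = ∑ x : ZMod p, -x := (Equiv.sum_comp (Equiv.neg _) _).symm
    rw [Finset.sum_neg_distrib] at h5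
    have h6 : (2 : ZMod p) ≠ 0 := by
      intro h
      have : ((2 : ℕ) : ZMod p) = 0 := by exact_mod_cast h
      rw [ZMod.natCast_eq_zero_iff] at this
      have := (Nat.prime_dvd_prime_iff_eq hp Nat.prime_two).mp this
      subst this
      exact absurd hodd (by decide)
    have h7 : 2 * ∑ x : ZMod p, x = 0 := by linear_combination h5
    exact (mul_eq_zero.mp h7).resolve_left h6
  rw [h4]; simp

lemma scale (f : MvPolynomial (Fin p) ℤ) (hs : f.IsSymmetric) (u : (ZMod p)ˣ) :
    (th c f).comp (Polynomial.C (u : ZMod p) * Polynomial.X) = th c f := by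
  let e : Equiv.Perm (Fin p) := (c.trans (Units.mulLeft u)).trans c.symm
  have he : ∀ k, c (e k) = u * c k := by intro k; simp [e]
  conv_rhs => rw [← hs e, aeval_rename]
  have : ((Polynomial.compRingHom (Polynomial.C (u : ZMod p) * Polynomial.X)).toIntAlgHom.comp
      (th c)) = aeval ((fun i => c i • Polynomial.X) ∘ e) := by
    apply MvPolynomial.algHom_ext
    intro i
    have h9 : th c (X i) = c i • Polynomial.X := aeval_X _ _
    change (th c (X i)).comp _ = _
    rw [h9, aeval_X, Function.comp_apply, he]
    simp [Polynomial.smul_eq_C_mul]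
    ring
  exact DFunLike.congr_fun this f

lemma mem_closure (Q : Polynomial (ZMod p)) (hd : Polynomial.derivative Q = 0)
    (hu : ∀ u : (ZMod p)ˣ, Q.comp (Polynomial.C (u : ZMod p) * Polynomial.X) = Q) :
    Q ∈ Subring.closure {(Polynomial.X ^ (p ^ 2 - p) : Polynomial (ZMod p))} := by
  have hp : p.Prime := Fact.out
  rw [Q.as_sum_support_C_mul_X_pow]
  refine Subring.sum_mem _ fun n hn => ?_
  rw [Polynomial.mem_support_iff] at hn
  have h1 : p ∣ n := by
    rcases n with _ | n
    · simp
    have := congrArg (fun q => Polynomial.coeff q n) hd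
    simp only [Polynomial.coeff_derivative, Polynomial.coeff_zero] at this
    have := (mul_eq_zero.mp this).resolve_left hn
    rw [← ZMod.natCast_eq_zero_iff]
    exact_mod_cast this
  have h2 : p - 1 ∣ n := by
    have : ∀ u : (ZMod p)ˣ, u ^ n = 1 := by
      intro u
      have := congrArg (fun q => Polynomial.coeff q n) (hu u)
      simp only [Polynomial.comp_C_mul_X_coeff] at this
      have := mul_left_cancel₀ hn (this.trans (mul_one _).symm)
      ext; simpa using this
    have := (FiniteField.forall_pow_eq_one_iff (ZMod p) n).mp this
    rwa [ZMod.card] at this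
  have h3 : p * (p - 1) ∣ n := Nat.Coprime.mul_dvd_of_dvd_of_dvd
    ((Nat.coprime_self_sub_right hp.one_lt.le).mpr (Nat.coprime_one_right p)) h1 h2
  have h4 : p ^ 2 - p = p * (p - 1) := by rw [Nat.mul_sub, mul_one, sq]
  obtain ⟨k, rfl⟩ := h3
  refine Subring.mul_mem _ ?_ ?_
  · generalize Q.coeff _ = a
    have : Polynomial.C a = ((a.val : ℕ) : Polynomial (ZMod p)) := by
      rw [← Polynomial.C_eq_natCast]; simp
    rw [this]
    exact natCast_mem _ _
  · rw [pow_mul, h4]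
    exact Subring.pow_mem _ (Subring.subset_closure (Set.mem_singleton _)) _

noncomputable def delta (p : ℕ) : MvPolynomial (Fin p) ℤ :=
  ∏ i : Fin p, ∏ j : Fin p, if i = j then 1 else (X i - X j)

lemma delta_symm : (delta p).IsSymmetric := by
  intro e
  unfold delta
  simp only [map_prod]
  conv_rhs => rw [← Equiv.prod_comp e]
  refine Finset.prod_congr rfl fun i _ => ?_
  conv_rhs => rw [← Equiv.prod_comp e]
  refine Finset.prod_congr rfl fun j _ => ?_
  by_cases h : i = j <;> simp [h]

lemma delta_nabla : (∑ i : Fin p, pderiv i) (delta p) = 0 := by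
  unfold delta
  have hmul : ∀ a b : MvPolynomial (Fin p) ℤ, (∑ i : Fin p, pderiv i) a = 0 →
      (∑ i : Fin p, pderiv i) b = 0 → (∑ i : Fin p, pderiv i) (a * b) = 0 := by
    intro a b ha hb
    rw [Derivation.leibniz, ha, hb]; simp
  refine Finset.prod_induction _ (fun q => (∑ i : Fin p, pderiv i) q = 0) hmul
    (Derivation.map_one_eq_zero _) fun i _ => ?_
  refine Finset.prod_induction _ (fun q => (∑ i : Fin p, pderiv i) q = 0) hmul
    (Derivation.map_one_eq_zero _) fun j _ => ?_
  split_ifs with h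
  · exact Derivation.map_one_eq_zero _
  · rw [sum_app]
    simp [pderiv_X, Pi.single_apply]

lemma th_delta : ∃ W : ZMod p, W ≠ 0 ∧
    th c (delta p) = Polynomial.C W * Polynomial.X ^ (p ^ 2 - p) := by
  have hinner : ∀ i : Fin p, (∏ j : Fin p, th c (if i = j then 1 else (X i - X j))) =
      Polynomial.C (∏ z ∈ Finset.univ.erase (0 : ZMod p), z) * Polynomial.X ^ (p - 1) := by
    intro i
    have h1 : ∀ j, th c (if i = j then 1 else (X i - X j)) =
        (fun z : ZMod p => if z = 0 then 1 else Polynomial.C z * Polynomial.X)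
          ((c.trans (Equiv.subLeft (c i))) j) := by
      intro j
      by_cases h : i = j
      · simp [h]
      · have : c i - c j ≠ 0 := fun h' => h (c.injective (sub_eq_zero.mp h'))
        simp [h, this, Polynomial.smul_eq_C_mul, sub_mul]
    simp only [h1]
    rw [Equiv.prod_comp (c.trans (Equiv.subLeft (c i)))
      (fun z : ZMod p => if z = 0 then 1 else Polynomial.C z * Polynomial.X)]
    rw [← Finset.mul_prod_erase _ _ (Finset.mem_univ (0 : ZMod p))]
    rw [if_pos rfl, one_mul, Finset.prod_congr rfl
      (g := fun z => Polynomial.C z * Polynomial.X) (fun z hz => if_neg (Finset.ne_of_mem_erase hz)),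
      Finset.prod_mul_distrib, map_prod]
    simp [Finset.card_erase_of_mem, ZMod.card]
  refine ⟨(∏ z ∈ Finset.univ.erase (0 : ZMod p), z) ^ p, ?_, ?_⟩
  · exact pow_ne_zero _ (Finset.prod_ne_zero_iff.mpr fun z hz => Finset.ne_of_mem_erase hz)
  · unfold delta
    rw [map_prod]
    simp only [map_prod (th c)]
    rw [Finset.prod_congr rfl fun i _ => hinner i]
    have h4 : p ^ 2 - p = (p - 1) * p := by rw [Nat.sub_mul, one_mul, sq]
    rw [Finset.prod_const, Finset.card_univ, Fintype.card_fin, mul_pow, h4, pow_mul, map_pow]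

end

end ThetaAux

open ThetaAux in
/-- Corollary 2.9 (Vistoli's Proposition 3.1): Θ_p(K_p) = ⟨η^{p²−p}⟩. -/
theorem theta_image_Kp (p : ℕ) (hp : p.Prime) (hodd : Odd p) :
    (MvPolynomial.aeval (fun i : Fin p => (((i : ℕ) + 1 : ZMod p)) • Polynomial.X) :
        MvPolynomial (Fin p) ℤ →ₐ[ℤ] Polynomial (ZMod p)) ''
      {f : MvPolynomial (Fin p) ℤ |
        f.IsSymmetric ∧ (∑ i : Fin p, MvPolynomial.pderiv i) f = 0} =
    ↑(Subring.closure {(Polynomial.X ^ (p ^ 2 - p) : Polynomial (ZMod p))}) := by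
  have : Fact p.Prime := ⟨hp⟩
  obtain ⟨c, hc⟩ := exists_c p
  simp only [← hc]
  apply Set.Subset.antisymm
  · rintro _ ⟨f, ⟨hs, hf⟩, rfl⟩
    rw [sum_app] at hf
    exact mem_closure _ (deriv_zero c hodd f hs hf) (scale c f hs)
  · intro q hq
    have hq' : q ∈ Subring.closure {(Polynomial.X ^ (p ^ 2 - p) : Polynomial (ZMod p))} := hq
    clear hq
    induction hq' using Subring.closure_induction with
    | mem x hx =>
      rw [Set.mem_singleton_iff] at hx
      subst hx
      obtain ⟨W, hW, h⟩ := th_delta c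
      refine ⟨C ((W⁻¹).val : ℤ) * delta p, ⟨?_, ?_⟩, ?_⟩
      · exact (IsSymmetric.C _).mul delta_symm
      · rw [Derivation.leibniz, delta_nabla, sum_app]
        simp only [pderiv_C, Finset.sum_const_zero, smul_zero, add_zero]
      · change th c _ = _
        rw [map_mul, h, ← mul_assoc]
        have : th c (C ((W⁻¹).val : ℤ)) = Polynomial.C W⁻¹ := by
          rw [aeval_C, eq_intCast, Int.cast_natCast, ← Polynomial.C_eq_natCast,
            ZMod.natCast_zmod_val]
        rw [this, ← map_mul, inv_mul_cancel₀ hW]; simp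
    | zero => exact ⟨0, ⟨IsSymmetric.zero, map_zero _⟩, map_zero _⟩
    | one => exact ⟨1, ⟨IsSymmetric.one, Derivation.map_one_eq_zero _⟩, map_one _⟩
    | add x y _ _ hx hy =>
      obtain ⟨a, ⟨ha, ha'⟩, rfl⟩ := hx
      obtain ⟨b, ⟨hb, hb'⟩, rfl⟩ := hy
      exact ⟨a + b, ⟨ha.add hb, by rw [map_add, ha', hb', add_zero]⟩, map_add _ _ _⟩
    | neg x _ hx =>
      obtain ⟨a, ⟨ha, ha'⟩, rfl⟩ := hx
      exact ⟨-a, ⟨ha.neg, by rw [map_neg, ha', neg_zero]⟩, map_neg _ _⟩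
    | mul x y _ _ hx hy =>
      obtain ⟨a, ⟨ha, ha'⟩, rfl⟩ := hx
      obtain ⟨b, ⟨hb, hb'⟩, rfl⟩ := hy
      exact ⟨a * b, ⟨ha.mul hb, by rw [Derivation.leibniz, ha', hb']; simp⟩, map_mul _ _ _⟩
end

section
/- Let p be an odd prime, ω = Complex.exp (2πi/p), and let s and t be the images in PU(p) := Matrix.unitaryGroup (Fin p) ℂ ⧸ Subgroup.center (Matrix.unitaryGroup (Fin p) ℂ) of the unitary matrices S (the permutation matrix with S i j = 1 if i = j + 1 in Fin p, else 0) and D (the diagonal matrix with D i i = ω^((i : ℕ) + 1)). Then the subgroup Γ = Subgroup.closure {s, t} of PU(p) is isomorphic as a group to ZMod p × ZMod p (i.e. Γ is elementary abelian of order p²). -/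
theorem Gamma_abstract {G : Type*} [Group G] (p : ℕ) (hp : p.Prime) (S D z : G)
    (hz : z ∈ Subgroup.center G) (hz1 : z ≠ 1) (hS : S ^ p = 1) (hD : D ^ p = 1)
    (h : D * S = z * (S * D)) :
    Nonempty ((Subgroup.closure
      {(QuotientGroup.mk S : G ⧸ Subgroup.center G), QuotientGroup.mk D}) ≃*
        Multiplicative (ZMod p × ZMod p)) := by
  haveI : Fact p.Prime := ⟨hp⟩
  have hzc : ∀ g, g * z = z * g := fun g => Subgroup.mem_center_iff.1 hz g
  have hconjS : D * S * D⁻¹ = z * S := by rw [h]; group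
  have hconjD : S * D * S⁻¹ = z⁻¹ * D := by
    rw [mul_inv_eq_iff_eq_mul, mul_assoc, h]; group
  have comz : ∀ g, Commute z g := fun g => (hzc g).symm
  have powS : ∀ a : ℤ, D * S ^ a * D⁻¹ = z ^ a * S ^ a := fun a => by
    rw [← conj_zpow, hconjS, (comz S).mul_zpow]
  have powD : ∀ a : ℤ, S * D ^ a * S⁻¹ = (z ^ a)⁻¹ * D ^ a := fun a => by
    rw [← conj_zpow, hconjD, (comz D).inv_left.mul_zpow, inv_zpow]
  have hzp : z ^ p = 1 := by
    have := powS p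
    simpa [hS] using this.symm
  have hord : orderOf z = p := orderOf_eq_prime hzp hz1
  have key : ∀ a b : ℤ, S ^ a * D ^ b ∈ Subgroup.center G → (a : ZMod p) = 0 ∧ (b : ZMod p) = 0 := by
    intro a b hab
    have hc := fun g => Subgroup.mem_center_iff.1 hab g
    have h1 : z ^ a = 1 := by
      have e : D * (S ^ a * D ^ b) * D⁻¹ = z ^ a * (S ^ a * D ^ b) := by
        rw [← mul_assoc (z ^ a), ← powS]; group
      rw [hc D, mul_inv_cancel_right] at e
      exact (mul_eq_right.1 e.symm)
    have h2 : z ^ b = 1 := by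
      have e : S⁻¹ * (S * (S ^ a * D ^ b) * S⁻¹) * S = (z ^ b)⁻¹ * (S ^ a * D ^ b) := by
        have e1 : S * (S ^ a * D ^ b) * S⁻¹ = S ^ a * (S * D ^ b * S⁻¹) := by group
        have e2 : S ^ a * (z ^ b)⁻¹ = (z ^ b)⁻¹ * S ^ a :=
          (((comz (S ^ a)).zpow_left b).inv_left).symm.eq
        rw [hc S, mul_inv_cancel_right] at e1
        rw [hc S, mul_inv_cancel_right, mul_assoc, ← hc S, inv_mul_cancel_left]
        rw [e1, powD, ← mul_assoc, e2, mul_assoc]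
        rw [powD, ← mul_assoc, e2, mul_assoc] at e1
        rw [← e1, ← e1]
      rw [hc S, mul_inv_cancel_right, mul_assoc, ← hc S, inv_mul_cancel_left] at e
      exact inv_eq_one.1 (mul_eq_right.1 e.symm)
    constructor
    · rw [ZMod.intCast_zmod_eq_zero_iff_dvd, ← hord]; exact orderOf_dvd_iff_zpow_eq_one.2 h1
    · rw [ZMod.intCast_zmod_eq_zero_iff_dvd, ← hord]; exact orderOf_dvd_iff_zpow_eq_one.2 h2
  let Q := G ⧸ Subgroup.center G
  let s : Q := QuotientGroup.mk S
  let t : Q := QuotientGroup.mk D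
  have hs : s ^ p = 1 := by
    change (QuotientGroup.mk (S ^ p) : Q) = 1
    rw [hS]; rfl
  have ht : t ^ p = 1 := by
    change (QuotientGroup.mk (D ^ p) : Q) = 1
    rw [hD]; rfl
  have hst : Commute s t := by
    change (QuotientGroup.mk (S * D) : Q) = QuotientGroup.mk (D * S)
    rw [h, QuotientGroup.eq, ← hzc]
    rwa [inv_mul_cancel_left]
  let f1 : ZMod p →+ Additive Q := ZMod.lift p ⟨zmultiplesHom _ (Additive.ofMul s), by
    simp [← ofMul_pow, hs]⟩
  let f2 : ZMod p →+ Additive Q := ZMod.lift p ⟨zmultiplesHom _ (Additive.ofMul t), by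
    simp [← ofMul_pow, ht]⟩
  have hf1 : ∀ a : ℤ, f1 a = Additive.ofMul (s ^ a) := fun a => by simp [f1]
  have hf2 : ∀ a : ℤ, f2 a = Additive.ofMul (t ^ a) := fun a => by simp [f2]
  let f : ZMod p × ZMod p →+ Additive Q := f1.noncommCoprod f2 (by
    intro x y
    obtain ⟨a, rfl⟩ := ZMod.intCast_surjective x
    obtain ⟨b, rfl⟩ := ZMod.intCast_surjective y
    rw [hf1, hf2]
    exact (hst.zpow_zpow a b).eq)
  let F : Multiplicative (ZMod p × ZMod p) →* Q := AddMonoidHom.toMultiplicativeLeft f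
  have hF : ∀ a b : ℤ, F (Multiplicative.ofAdd ((a : ZMod p), (b : ZMod p))) = s ^ a * t ^ b := by
    intro a b
    change (f1 a + f2 b).toMul = _
    rw [hf1, hf2]; rfl
  have hinj : Function.Injective F := by
    rw [injective_iff_map_eq_one]
    intro x hx
    obtain ⟨x, y⟩ := x
    obtain ⟨a, rfl⟩ := ZMod.intCast_surjective x
    obtain ⟨b, rfl⟩ := ZMod.intCast_surjective y
    have h3 := (hF a b).symm.trans hx
    have h4 : (QuotientGroup.mk (S ^ a * D ^ b) : Q) = 1 := h3
    obtain ⟨ha, hb⟩ := key a b ((QuotientGroup.eq_one_iff _).1 h4)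
    rw [ha, hb]; rfl
  have hrange : F.range = Subgroup.closure {s, t} := by
    apply le_antisymm
    · rintro _ ⟨⟨x, y⟩, rfl⟩
      obtain ⟨a, rfl⟩ := ZMod.intCast_surjective x
      obtain ⟨b, rfl⟩ := ZMod.intCast_surjective y
      have := hF a b
      have h5 : s ^ a * t ^ b ∈ Subgroup.closure {s, t} :=
        mul_mem (zpow_mem (Subgroup.subset_closure (by simp)) _)
          (zpow_mem (Subgroup.subset_closure (by simp)) _)
      rw [← this] at h5
      exact h5
    · rw [Subgroup.closure_le]
      rintro x (rfl | rfl)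
      · exact ⟨_, (hF 1 0).trans (by simp)⟩
      · exact ⟨_, (hF 0 1).trans (by simp)⟩
  exact ⟨((MonoidHom.ofInjective hinj).trans (MulEquiv.subgroupCongr hrange)).symm⟩

/-- Γ = ⟨σ, τ⟩ ⊂ PU(p) is elementary abelian of order p²: Γ ≅ 𝔽_p × 𝔽_p. -/
theorem Gamma_iso_ZMod_p_sq (p : ℕ) [NeZero p] (hp : p.Prime) (hodd : Odd p)
    (ω : ℂ) (hω : ω = Complex.exp (2 * Real.pi * Complex.I / p))
    (S' D' : Matrix.unitaryGroup (Fin p) ℂ)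
    (hS : (S' : Matrix (Fin p) (Fin p) ℂ) =
      Matrix.of (fun i j : Fin p => if i = j + 1 then (1 : ℂ) else 0))
    (hD : (D' : Matrix (Fin p) (Fin p) ℂ) =
      Matrix.diagonal (fun i : Fin p => ω ^ ((i : ℕ) + 1))) :
    Nonempty
      ((Subgroup.closure
          {(QuotientGroup.mk S' :
            Matrix.unitaryGroup (Fin p) ℂ ⧸ Subgroup.center (Matrix.unitaryGroup (Fin p) ℂ)),
           QuotientGroup.mk D'}) ≃* Multiplicative (ZMod p × ZMod p)) := by
  have hprim : IsPrimitiveRoot ω p := hω ▸ Complex.isPrimitiveRoot_exp p hp.ne_zero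
  have hnorm : ‖ω‖ = 1 := hprim.norm'_eq_one hp.ne_zero
  have hωω : star ω * ω = 1 := by
    have := Complex.conj_mul' ω
    simpa [hnorm] using this
  have hU : ω • (1 : Matrix (Fin p) (Fin p) ℂ) ∈ Matrix.unitaryGroup (Fin p) ℂ := by
    rw [Matrix.mem_unitaryGroup_iff']
    rw [star_smul, star_one, smul_mul_smul_comm, hωω]; simp
  refine Gamma_abstract p hp S' D' ⟨_, hU⟩ ?_ ?_ ?_ ?_ ?_
  · rw [Subgroup.mem_center_iff]
    intro g
    apply Subtype.ext
    simp
  · intro h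
    have := congrArg (fun M : Matrix.unitaryGroup (Fin p) ℂ => (M : Matrix (Fin p) (Fin p) ℂ) 0 0) h
    simp at this
    exact hprim.ne_one hp.one_lt this
  · have hk : ∀ k : ℕ, (S' : Matrix (Fin p) (Fin p) ℂ) ^ k =
      Matrix.of (fun i j : Fin p => if i = j + (Fin.ofNat p k) then (1 : ℂ) else 0) := by
      intro k
      induction k with
      | zero =>
        ext i j
        simp [Matrix.one_apply]
      | succ k ih =>
        ext i j
        have e : (Fin.ofNat p (k + 1) : Fin p) = 1 + Fin.ofNat p k := by
          apply Fin.ext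
          simp [Fin.val_add, add_comm]
        rw [pow_succ, ih, hS, Matrix.mul_apply, e]
        simp [add_assoc]
    apply Subtype.ext
    rw [SubmonoidClass.coe_pow, hk]
    ext i j
    have e : (Fin.ofNat p p : Fin p) = 0 := by
      apply Fin.ext
      simp
    simp [Matrix.one_apply, e]
  · apply Subtype.ext
    rw [SubmonoidClass.coe_pow, hD, Matrix.diagonal_pow]
    change _ = (1 : Matrix (Fin p) (Fin p) ℂ)
    rw [← Matrix.diagonal_one]
    congr 1
    ext i
    simp only [Pi.pow_apply]
    rw [← pow_mul, mul_comm, pow_mul, hprim.pow_eq_one, one_pow]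
  · apply Subtype.ext
    change (D' : Matrix (Fin p) (Fin p) ℂ) * (S' : Matrix (Fin p) (Fin p) ℂ) =
      (ω • (1 : Matrix (Fin p) (Fin p) ℂ)) *
        ((S' : Matrix (Fin p) (Fin p) ℂ) * (D' : Matrix (Fin p) (Fin p) ℂ))
    rw [hD, hS]
    ext i j
    rw [smul_mul_assoc, one_mul, Matrix.smul_apply, Matrix.diagonal_mul, Matrix.mul_diagonal]
    simp only [Matrix.of_apply, smul_eq_mul]
    split_ifs with hij
    · subst hij
      have : ω ^ ((j + 1 : Fin p) : ℕ) = ω ^ ((j : ℕ) + 1) := by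
        have e : ((j + 1 : Fin p) : ℕ) = ((j : ℕ) + 1) % p := by
          rw [Fin.val_add, Fin.val_one', Nat.add_mod_mod]
        rw [e]
        conv_rhs => rw [← Nat.mod_add_div ((j : ℕ) + 1) p, pow_add, pow_mul,
          hprim.pow_eq_one, one_pow, mul_one]
      rw [pow_succ, this]; ring
    · simp
end

section
/- Let p be an odd prime and f = (X 0)^p * (X 1) − (X 1)^p * (X 0) ∈ MvPolynomial (Fin 2) (ZMod p). Then for every M in the special linear group Matrix.SpecialLinearGroup (Fin 2) (ZMod p), the algebra endomorphism φ_M of MvPolynomial (Fin 2) (ZMod p) determined by X i ↦ ∑_{j : Fin 2} C (M i j) * X j satisfies φ_M f = f. -/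
open MvPolynomial

/-- The Dickson invariant f = ξ^p η − η^p ξ is SL₂(𝔽_p)-invariant. -/
theorem dickson_f_invariant (p : ℕ) (hp : p.Prime) (hodd : Odd p)
    (M : Matrix.SpecialLinearGroup (Fin 2) (ZMod p)) :
    MvPolynomial.aeval
      (fun i : Fin 2 => ∑ j : Fin 2,
        MvPolynomial.C ((M : Matrix (Fin 2) (Fin 2) (ZMod p)) i j) * MvPolynomial.X j)
      ((MvPolynomial.X 0) ^ p * (MvPolynomial.X 1) -
        (MvPolynomial.X 1) ^ p * (MvPolynomial.X 0) : MvPolynomial (Fin 2) (ZMod p)) =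
    (MvPolynomial.X 0) ^ p * (MvPolynomial.X 1) -
      (MvPolynomial.X 1) ^ p * (MvPolynomial.X 0) := by
  haveI : Fact p.Prime := ⟨hp⟩
  have hdet : (C (M.1 0 0) * C (M.1 1 1) - C (M.1 0 1) * C (M.1 1 0) :
      MvPolynomial (Fin 2) (ZMod p)) = 1 := by
    have h := M.2
    rw [Matrix.det_fin_two] at h
    rw [← C_mul, ← C_mul, ← C_sub, h, C_1]
  have hC : ∀ a : ZMod p, (C a : MvPolynomial (Fin 2) (ZMod p)) ^ p = C a := by
    intro a
    rw [← C_pow, ZMod.pow_card]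
  simp only [map_sub, map_mul, map_pow, aeval_X, Fin.sum_univ_two, add_pow_char, mul_pow, hC]
  linear_combination ((X 0) ^ p * (X 1) - (X 1) ^ p * (X 0) :
      MvPolynomial (Fin 2) (ZMod p)) * hdet
end

section
/- Let p be an odd prime and h = (X 0)^(p² − p) + (X 1)^(p − 1) * ((X 0)^(p − 1) − (X 1)^(p − 1))^(p − 1) ∈ MvPolynomial (Fin 2) (ZMod p). Then for every M in the special linear group Matrix.SpecialLinearGroup (Fin 2) (ZMod p), the algebra endomorphism φ_M of MvPolynomial (Fin 2) (ZMod p) determined by X i ↦ ∑_{j : Fin 2} C (M i j) * X j satisfies φ_M h = h. -/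
open MvPolynomial

lemma dickson_key {R : Type*} [CommRing R] (p : ℕ) [Fact p.Prime] [CharP R p] (x y : R) :
    (x ^ (p ^ 2 - p) + y ^ (p - 1) * (x ^ (p - 1) - y ^ (p - 1)) ^ (p - 1)) *
      (x ^ p * y - x * y ^ p) = x ^ p ^ 2 * y - x * y ^ p ^ 2 := by
  obtain ⟨q, hq⟩ : ∃ q, p = q + 1 := ⟨p - 1, by have := (Fact.out : p.Prime).pos; omega⟩
  have h1 : p - 1 = q := by omega
  have h2 : p ^ 2 - p = q * p := by rw [hq, pow_two, Nat.add_mul, one_mul, Nat.add_sub_cancel]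
  have h3 : p ^ 2 = q * p + p := by rw [hq]; ring
  have h4 : (x ^ q - y ^ q) ^ q * (x ^ q - y ^ q) = x ^ (q * p) - y ^ (q * p) := by
    rw [← pow_succ, ← hq, sub_pow_char, ← pow_mul, ← pow_mul]
  have hx : ∀ z : R, z ^ p = z ^ q * z := fun z => by rw [hq, pow_succ]
  rw [h1, h2, h3, pow_add, pow_add, hx x, hx y]
  linear_combination (x * y * y ^ q) * h4

lemma dickson_frob {R : Type*} [CommRing R] (p : ℕ) [Fact p.Prime] [CharP R p]
    (a b c d x y : R) (n : ℕ) (ha : a ^ p = a) (hb : b ^ p = b) (hc : c ^ p = c) (hd : d ^ p = d)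
    (hdet : a * d - b * c = 1) :
    (a * x + b * y) ^ p ^ n * (c * x + d * y) - (a * x + b * y) * (c * x + d * y) ^ p ^ n =
      x ^ p ^ n * y - x * y ^ p ^ n := by
  have key : ∀ z : R, z ^ p = z → z ^ p ^ n = z := by
    intro z hz
    induction n with
    | zero => simp
    | succ k ih => rw [pow_succ, pow_mul, ih, hz]
  rw [add_pow_char_pow, add_pow_char_pow]
  simp only [mul_pow, key a ha, key b hb, key c hc, key d hd]
  linear_combination (x ^ p ^ n * y - x * y ^ p ^ n) * hdet

/-- The Dickson invariant h = ξ^{p²−p} + η^{p−1}(ξ^{p−1} − η^{p−1})^{p−1}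
is SL₂(𝔽_p)-invariant. -/
theorem dickson_h_invariant (p : ℕ) (hp : p.Prime) (hodd : Odd p)
    (M : Matrix.SpecialLinearGroup (Fin 2) (ZMod p)) :
    MvPolynomial.aeval
      (fun i : Fin 2 => ∑ j : Fin 2,
        MvPolynomial.C ((M : Matrix (Fin 2) (Fin 2) (ZMod p)) i j) * MvPolynomial.X j)
      ((MvPolynomial.X 0) ^ (p ^ 2 - p) +
        (MvPolynomial.X 1) ^ (p - 1) *
          ((MvPolynomial.X 0) ^ (p - 1) - (MvPolynomial.X 1) ^ (p - 1)) ^ (p - 1) :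
        MvPolynomial (Fin 2) (ZMod p)) =
    (MvPolynomial.X 0) ^ (p ^ 2 - p) +
      (MvPolynomial.X 1) ^ (p - 1) *
        ((MvPolynomial.X 0) ^ (p - 1) - (MvPolynomial.X 1) ^ (p - 1)) ^ (p - 1) := by
  haveI : Fact p.Prime := ⟨hp⟩
  have hC : ∀ z : ZMod p, (C z : MvPolynomial (Fin 2) (ZMod p)) ^ p = C z := by
    intro z
    rw [← C_pow, ZMod.pow_card]
  have hdet : (C (M.1 0 0) * C (M.1 1 1) - C (M.1 0 1) * C (M.1 1 0) :
      MvPolynomial (Fin 2) (ZMod p)) = 1 := by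
    have h := M.2
    rw [Matrix.det_fin_two] at h
    rw [← C_mul, ← C_mul, ← C_sub, h, C_1]
  have hD : (X 0 ^ p * X 1 - X 0 * X 1 ^ p : MvPolynomial (Fin 2) (ZMod p)) ≠ 0 := by
    intro h
    have h' := congrArg (aeval ![(Polynomial.X : Polynomial (ZMod p)), 1]) h
    simp at h'
    exact FiniteField.X_pow_card_sub_X_ne_zero (ZMod p) hp.one_lt h'
  have hf := fun n => dickson_frob p _ _ _ _ (X 0 : MvPolynomial (Fin 2) (ZMod p)) (X 1) n
    (hC (M.1 0 0)) (hC (M.1 0 1)) (hC (M.1 1 0)) (hC (M.1 1 1)) hdet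
  have hf1 := hf 1
  rw [pow_one] at hf1
  apply mul_right_cancel₀ hD
  rw [dickson_key, ← hf 2, ← dickson_key, hf1]
  simp [Fin.sum_univ_two]
end

section
/- In MvPolynomial (Fin 3) (ZMod 3), the polynomial ∏_{(i,j) : Fin 3 × Fin 3, i ≠ j} (X i − X j) equals e₁³·e₃ − e₁²·e₂² + e₂³, where eₖ = MvPolynomial.esymm (Fin 3) (ZMod 3) k is the k-th elementary symmetric polynomial. -/
open MvPolynomial

/-- δ ≡ e₁³e₃ − e₁²e₂² + e₂³ (mod 3). -/
theorem delta_mod_three :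
    (∏ ij ∈ Finset.univ.filter (fun ij : Fin 3 × Fin 3 => ij.1 ≠ ij.2),
        (MvPolynomial.X ij.1 - MvPolynomial.X ij.2 : MvPolynomial (Fin 3) (ZMod 3))) =
      (MvPolynomial.esymm (Fin 3) (ZMod 3) 1) ^ 3 * MvPolynomial.esymm (Fin 3) (ZMod 3) 3 -
        (MvPolynomial.esymm (Fin 3) (ZMod 3) 1) ^ 2 * (MvPolynomial.esymm (Fin 3) (ZMod 3) 2) ^ 2 +
        (MvPolynomial.esymm (Fin 3) (ZMod 3) 2) ^ 3 := by
  have h3 : (3 : MvPolynomial (Fin 3) (ZMod 3)) = 0 := by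
    exact_mod_cast CharP.cast_eq_zero (MvPolynomial (Fin 3) (ZMod 3)) 3
  have e1 : MvPolynomial.esymm (Fin 3) (ZMod 3) 1 = X 0 + X 1 + X 2 := by
    rw [MvPolynomial.esymm_one, Fin.sum_univ_three]
  have e2 : MvPolynomial.esymm (Fin 3) (ZMod 3) 2 = X 0 * X 1 + X 0 * X 2 + X 1 * X 2 := by
    have h : Finset.powersetCard 2 (Finset.univ : Finset (Fin 3)) = {{0, 1}, {0, 2}, {1, 2}} := by
      decide
    rw [MvPolynomial.esymm, h, Finset.sum_insert (by decide), Finset.sum_insert (by decide),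
      Finset.sum_singleton, Finset.prod_pair (by decide), Finset.prod_pair (by decide),
      Finset.prod_pair (by decide)]
    ring
  have e3 : MvPolynomial.esymm (Fin 3) (ZMod 3) 3 = X 0 * X 1 * X 2 := by
    have h : Finset.powersetCard 3 (Finset.univ : Finset (Fin 3)) = {Finset.univ} := by
      decide
    rw [MvPolynomial.esymm, h, Finset.sum_singleton, Fin.prod_univ_three]
  rw [e1, e2, e3, Finset.prod_filter, Fintype.prod_prod_type]
  simp only [Fin.prod_univ_three]
  simp only [ne_eq, not_true_eq_false, if_false, Fin.reduceEq, not_false_eq_true, if_true,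
    one_mul, mul_one]
  generalize (X 0 : MvPolynomial (Fin 3) (ZMod 3)) = a at *
  generalize (X 1 : MvPolynomial (Fin 3) (ZMod 3)) = b at *
  generalize (X 2 : MvPolynomial (Fin 3) (ZMod 3)) = c at *
  linear_combination ((a * b + a * c + b * c) ^ 3 + (a + b + c) ^ 3 * (a * b * c)
    - 6 * (a + b + c) * (a * b + a * c + b * c) * (a * b * c) + 9 * (a * b * c) ^ 2) * h3
end
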